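/- Let α and β be irrational real numbers and C > 0 a constant with ‖qα‖ ≥ C/q and ‖qβ‖ ≥ C/q for every positive integer q. Let ε > 0, let N be a positive integer, and let x, y, z be integers with 1 ≤ x ≤ N, δ_α := |αx − y| ≤ N^{−1/2}, δ_β := |βx − z| ≤ N^{−1/2}, and x·δ_α·δ_β ≥ ε. Then there exist constants c₁, c₂ > 0 depending only on ε and C (and not on n, N, x, y, z) such that for every n ∈ ℕ: c₁·( N + q_{2n}(α)²/N + q_{2n}(β)²/N ) ≤ x + δ_α/e_{2n}(α) + δ_β/e_{2n}(β) ≤ c₂·( N + (q_{2n}(α)² + q_{2n}(β)²)/√N ). -/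

import Mathlib

namespace GenContFract

open GenContFract (of)

/-- The continuants of a regular continued fraction are integers. -/
theorem exists_int_eq_contsAux (v : ℝ) (n : ℕ) :
    ∃ a b : ℤ, ((of v).contsAux n).a = a ∧ ((of v).contsAux n).b = b := by
  induction n using Nat.strong_induction_on with
  | _ n ih =>
    rcases n with _ | _ | n
    · exact ⟨1, 0, by simp [contsAux]⟩
    · exact ⟨⌊v⌋, 1, by simp [contsAux]⟩
    · obtain ⟨a₁, b₁, ha₁, hb₁⟩ := ih (n + 1) (by omega)
      cases hs : (of v).s.get? n with
      | none =>
        have hstable : (of v).contsAux (n + 2) = (of v).contsAux (n + 1) :=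
          contsAux_stable_of_terminated (n + 1).le_succ hs
        exact ⟨a₁, b₁, by rw [hstable]; exact ⟨ha₁, hb₁⟩⟩
      | some gp =>
        obtain ⟨a₀, b₀, ha₀, hb₀⟩ := ih n (by omega)
        obtain ⟨ha, z, hz⟩ := of_partNum_eq_one_and_exists_int_partDen_eq hs
        refine ⟨z * a₁ + a₀, z * b₁ + b₀, ?_⟩
        rw [contsAux_recurrence hs rfl rfl]
        simp [ha, hz, ha₀, hb₀, ha₁, hb₁]

theorem not_terminatedAt_of_irrational {v : ℝ} (hv : Irrational v) (n : ℕ) :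
    ¬(of v).TerminatedAt n := fun h =>
  have ⟨q, hq⟩ := exists_rat_eq_of_terminates ⟨n, h⟩
  hv ⟨q, hq.symm⟩

theorem one_le_dens_of_irrational {v : ℝ} (hv : Irrational v) (n : ℕ) :
    1 ≤ (of v).dens n := by
  have h := succ_nth_fib_le_of_nth_den (v := v) (n := n)
    (Or.inr (not_terminatedAt_of_irrational hv _))
  have hfib : (1 : ℝ) ≤ Nat.fib (n + 1) := by
    exact_mod_cast Nat.fib_pos.2 n.succ_pos
  exact hfib.trans h

theorem sub_convs_pos_of_even {v : ℝ} (hv : Irrational v) {n : ℕ} (hn : Even n) :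
    0 < v - (of v).convs n := by
  obtain ⟨ifp, hifp⟩ : ∃ ifp, IntFractPair.stream v n = some ifp := by
    rw [← Option.ne_none_iff_exists']
    intro h
    exact not_terminatedAt_of_irrational hv n
      (of_terminatedAt_n_iff_succ_nth_intFractPair_stream_eq_none.2
        (IntFractPair.stream_isSeq v h))
  have hne : v - (of v).convs n ≠ 0 := by
    obtain ⟨q, hq⟩ := exists_rat_eq_nth_conv v n
    rw [hq, sub_ne_zero]
    exact fun h => hv ⟨q, h.symm⟩
  refine lt_of_le_of_ne ?_ hne.symm
  have heq := sub_convs_eq hifp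
  simp only [hn.neg_one_pow] at heq
  rw [heq]
  have hB : 0 ≤ ((of v).contsAux (n + 1)).b := zero_le_of_contsAux_b
  have hpB : 0 ≤ ((of v).contsAux n).b := zero_le_of_contsAux_b
  have hfr : 0 ≤ ifp.fr := IntFractPair.nth_stream_fr_nonneg hifp
  split_ifs
  · exact le_rfl
  · positivity

theorem abs_sub_convs_mul_dens_sq_le_one {v : ℝ} (hv : Irrational v) (n : ℕ) :
    |v - (of v).convs n| * (of v).dens n ^ 2 ≤ 1 := by
  have h := abs_sub_convs_le (not_terminatedAt_of_irrational hv n)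
  have hpos : 0 < (of v).dens n := one_pos.trans_le (one_le_dens_of_irrational hv n)
  have hmono : (of v).dens n ≤ (of v).dens (n + 1) := of_den_mono
  rw [← le_div_iff₀ (by positivity)]
  refine h.trans (one_div_le_one_div_of_le (by positivity) ?_)
  rw [sq]
  gcongr

theorem le_abs_sub_convs_mul_dens_sq {v C : ℝ} (hv : Irrational v)
    (hbad : ∀ q : ℕ, 0 < q → C / (q : ℝ) ≤ |(q : ℝ) * v - round ((q : ℝ) * v)|) (n : ℕ) :
    C ≤ |v - (of v).convs n| * (of v).dens n ^ 2 := by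
  have hpos : 0 < (of v).dens n := one_pos.trans_le (one_le_dens_of_irrational hv n)
  obtain ⟨p, b, hp, hb⟩ := exists_int_eq_contsAux v (n + 1)
  rw [← nth_cont_eq_succ_nth_contAux, ← num_eq_conts_a] at hp
  rw [← nth_cont_eq_succ_nth_contAux, ← den_eq_conts_b] at hb
  have hbpos : 0 < b := by exact_mod_cast hb ▸ hpos
  lift b to ℕ using hbpos.le
  rw [Int.cast_natCast] at hb
  have hle := (hbad b (by exact_mod_cast hbpos)).trans (round_le _ p)
  rw [← hb, ← hp, div_le_iff₀ hpos] at hle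
  refine hle.trans_eq ?_
  rw [conv_eq_num_div_den, sq, ← mul_assoc]
  congr 1
  nth_rewrite 3 [← abs_of_pos hpos]
  rw [← abs_mul, sub_mul, div_mul_cancel₀ _ hpos.ne', mul_comm v]

/-- At even indices the error of the convergents of a badly approximable number is positive and
comparable to the inverse square of the denominator. -/
theorem mul_dens_sq_le_div_sub_convs {v C δ : ℝ} (hv : Irrational v) (hC : 0 < C) (hδ : 0 ≤ δ)
    (hbad : ∀ q : ℕ, 0 < q → C / (q : ℝ) ≤ |(q : ℝ) * v - round ((q : ℝ) * v)|)
    {n : ℕ} (hn : Even n) :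
    δ * (of v).dens n ^ 2 ≤ δ / (v - (of v).convs n) ∧
      δ / (v - (of v).convs n) ≤ δ * (of v).dens n ^ 2 / C := by
  have hpos := sub_convs_pos_of_even hv hn
  have h₁ := abs_sub_convs_mul_dens_sq_le_one hv n
  have h₂ := le_abs_sub_convs_mul_dens_sq hv hbad n
  rw [abs_of_pos hpos] at h₁ h₂
  constructor
  · rw [le_div_iff₀ hpos]
    nlinarith
  · rw [div_le_div_iff₀ hpos hC]
    nlinarith

end GenContFract

theorem div_le_of_le_mul_mul {ε N s x a b : ℝ} (hs : 0 < s) (hN : s * s = N)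
    (hx : 0 ≤ x) (hxN : x ≤ N) (ha : 0 ≤ a) (hb : b ≤ 1 / s) (h : ε ≤ x * a * b) :
    ε / s ≤ a := by
  have h' : x * a * b ≤ N * a * (1 / s) :=
    (mul_le_mul_of_nonneg_left hb (by positivity)).trans (by gcongr)
  rw [div_le_iff₀ hs]
  refine (h.trans h').trans_eq ?_
  rw [← hN]
  field_simp

/-- Estimate for the first elementary symmetric function
`Σ₁ = x + δ_α/e_{2n}(α) + δ_β/e_{2n}(β)` of the roots of the auxiliary cubic:
`c₁·(N + q_{2n}(α)²/N + q_{2n}(β)²/N) ≤ Σ₁ ≤ c₂·(N + (q_{2n}(α)² + q_{2n}(β)²)/√N)`,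
with constants depending only on `ε` and the bad-approximability constant `C`. -/
theorem sigma1_estimate (ε C : ℝ) (hε : 0 < ε) (hC : 0 < C) :
    ∃ c₁ c₂ : ℝ, 0 < c₁ ∧ 0 < c₂ ∧
      ∀ α β : ℝ, Irrational α → Irrational β →
        (∀ q : ℕ, 0 < q → C / (q : ℝ) ≤ |(q : ℝ) * α - round ((q : ℝ) * α)|) →
        (∀ q : ℕ, 0 < q → C / (q : ℝ) ≤ |(q : ℝ) * β - round ((q : ℝ) * β)|) →
        ∀ N : ℕ, 0 < N → ∀ x y z : ℤ,
          1 ≤ x → (x : ℝ) ≤ N →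
          |α * x - y| ≤ (N : ℝ) ^ (-(1 : ℝ) / 2) →
          |β * x - z| ≤ (N : ℝ) ^ (-(1 : ℝ) / 2) →
          ε ≤ (x : ℝ) * |α * x - y| * |β * x - z| →
          ∀ n : ℕ,
            c₁ * ((N : ℝ) + (GenContFract.of α).dens (2 * n) ^ 2 / N +
                (GenContFract.of β).dens (2 * n) ^ 2 / N) ≤
              (x : ℝ) + |α * x - y| / (α - (GenContFract.of α).convs (2 * n)) +
                |β * x - z| / (β - (GenContFract.of β).convs (2 * n)) ∧
            (x : ℝ) + |α * x - y| / (α - (GenContFract.of α).convs (2 * n)) +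
                |β * x - z| / (β - (GenContFract.of β).convs (2 * n)) ≤
              c₂ * ((N : ℝ) + ((GenContFract.of α).dens (2 * n) ^ 2 +
                (GenContFract.of β).dens (2 * n) ^ 2) / Real.sqrt N) := by
  refine ⟨ε, 1 + 1 / C, hε, by positivity, ?_⟩
  intro α β hα hβ hαC hβC N hN x y z hx hxN hδα hδβ hprod n
  obtain ⟨hα₁, hα₂⟩ := GenContFract.mul_dens_sq_le_div_sub_convs hα hC
    (abs_nonneg (α * x - y)) hαC (even_two_mul n)
  obtain ⟨hβ₁, hβ₂⟩ := GenContFract.mul_dens_sq_le_div_sub_convs hβ hC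
    (abs_nonneg (β * x - z)) hβC (even_two_mul n)
  have hN₁ : (1 : ℝ) ≤ N := by exact_mod_cast hN
  have hx₀ : (0 : ℝ) ≤ x := by exact_mod_cast (zero_le_one.trans hx)
  have hpow : (N : ℝ) ^ (-(1 : ℝ) / 2) = 1 / √(N : ℝ) := by
    rw [neg_div, Real.rpow_neg (by positivity), Real.sqrt_eq_rpow, one_div ((N : ℝ) ^ _)]
  rw [hpow] at hδα hδβ
  have hs : 0 < √(N : ℝ) := by positivity
  have hss : √(N : ℝ) * √(N : ℝ) = N := Real.mul_self_sqrt (by positivity)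
  have hsN : √(N : ℝ) ≤ N := by
    nlinarith [Real.one_le_sqrt.2 hN₁]
  generalize √(N : ℝ) = s at *
  have hP := sq_nonneg ((GenContFract.of α).dens (2 * n))
  have hQ := sq_nonneg ((GenContFract.of β).dens (2 * n))
  have ha := abs_nonneg (α * x - y)
  have hb := abs_nonneg (β * x - z)
  generalize |α * x - y| / (α - (GenContFract.of α).convs (2 * n)) = A at *
  generalize |β * x - z| / (β - (GenContFract.of β).convs (2 * n)) = B at *
  generalize (GenContFract.of α).dens (2 * n) ^ 2 = P at *
  generalize (GenContFract.of β).dens (2 * n) ^ 2 = Q at *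
  generalize |α * x - y| = a at *
  generalize |β * x - z| = b at *
  have haε : ε / s ≤ a := div_le_of_le_mul_mul hs hss hx₀ hxN ha hδβ hprod
  have hbε : ε / s ≤ b :=
    div_le_of_le_mul_mul hs hss hx₀ hxN hb hδα (by rwa [mul_right_comm])
  have hNs : ε / N ≤ ε / s := by gcongr
  constructor
  · have hxε : ε * N ≤ x := by
      have hab : x * a * b ≤ x * (1 / s) * (1 / s) := by gcongr
      have h : ε ≤ x / N := by
        refine (hprod.trans hab).trans_eq ?_
        rw [← hss]
        field_simp
      rwa [le_div_iff₀ (by positivity)] at h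
    have hA : ε / N * P ≤ A := (mul_le_mul_of_nonneg_right (hNs.trans haε) hP).trans hα₁
    have hB : ε / N * Q ≤ B := (mul_le_mul_of_nonneg_right (hNs.trans hbε) hQ).trans hβ₁
    calc ε * (N + P / N + Q / N) = ε * N + ε / N * P + ε / N * Q := by ring
      _ ≤ x + A + B := by gcongr
  · have hA : A ≤ 1 / s * P / C := hα₂.trans (by gcongr)
    have hB : B ≤ 1 / s * Q / C := hβ₂.trans (by gcongr)
    have hrest : 0 ≤ N / C + (P + Q) / s := by positivity
    calc x + A + B ≤ N + 1 / s * P / C + 1 / s * Q / C := by gcongr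
      _ ≤ N + 1 / s * P / C + 1 / s * Q / C + (N / C + (P + Q) / s) :=
        le_add_of_nonneg_right hrest
      _ = (1 + 1 / C) * (N + (P + Q) / s) := by ring
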